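/- Let ρ ⊆ X × Y be a relation whose domain is ε-dense in (X,d) and whose image is μ-dense in (Y,D), and let ρ̄ be its cartographic generalization. If (x₁,y), (x₂,y) ∈ ρ̄ (two points of X represented by the same pixel y ∈ Y in the generalized map), then d(x₁,x₂) ≤ 2(ε + μ) + acc(ρ). -/

import Mathlib

open Metric ENNReal

variable {X Y : Type*} [MetricSpace X] [MetricSpace Y]

/-- The accuracy of a relation `ρ ⊆ X × Y`:
`acc(ρ) = sup{ |D(y₁,y₂) − d(x₁,x₂)| : (x₁,y₁) ∈ ρ, (x₂,y₂) ∈ ρ }`, in `[0,∞]`. -/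
noncomputable def accRel (ρ : Set (X × Y)) : ℝ≥0∞ :=
  ⨆ (p : X × Y) (_ : p ∈ ρ) (q : X × Y) (_ : q ∈ ρ),
    ENNReal.ofReal |dist p.2 q.2 - dist p.1 q.1|

/-- The resolution of a relation `ρ ⊆ X × Y`:
`res(ρ) = sup{ d(x₁,x₂) : ∃ y, (x₁,y) ∈ ρ and (x₂,y) ∈ ρ }`, in `[0,∞]`. -/
noncomputable def resRel (ρ : Set (X × Y)) : ℝ≥0∞ :=
  ⨆ (x₁ : X) (x₂ : X) (z : Y) (_ : (x₁, z) ∈ ρ ∧ (x₂, z) ∈ ρ),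
    ENNReal.ofReal (dist x₁ x₂)

/-- The precision of a relation `ρ ⊆ X × Y`:
`prec(ρ) = sup{ D(y₁,y₂) : ∃ x, (x,y₁) ∈ ρ and (x,y₂) ∈ ρ }`, in `[0,∞]`. -/
noncomputable def precRel (ρ : Set (X × Y)) : ℝ≥0∞ :=
  ⨆ (y₁ : Y) (y₂ : Y) (x : X) (_ : (x, y₁) ∈ ρ ∧ (x, y₂) ∈ ρ),
    ENNReal.ofReal (dist y₁ y₂)

/-- A subset `M ⊆ X` is `ε`-dense if every point of `X` is within distance `ε` of `M`. -/
def IsEpsDense (M : Set X) (ε : ℝ) : Prop :=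
  ∀ u : X, ∃ m ∈ M, dist m u ≤ ε

/-- The cartographic generalization `ρ̄` of a relation `ρ ⊆ X × Y`:
`(x,y) ∈ ρ̄` iff there is `(x',y') ∈ ρ` with `d(x,x') ≤ ε` and `D(y,y') ≤ μ`. -/
def cartGen (ρ : Set (X × Y)) (ε μ : ℝ) : Set (X × Y) :=
  {p | ∃ q ∈ ρ, dist p.1 q.1 ≤ ε ∧ dist p.2 q.2 ≤ μ}

theorem ofReal_abs_dist_sub_dist_le_accRel {ρ : Set (X × Y)} {p q : X × Y}
    (hp : p ∈ ρ) (hq : q ∈ ρ) :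
    ENNReal.ofReal |dist p.2 q.2 - dist p.1 q.1| ≤ accRel ρ :=
  (le_iSup₂ (f := fun (r : X × Y) (_ : r ∈ ρ) => ENNReal.ofReal |dist p.2 r.2 - dist p.1 r.1|)
    q hq).trans
    (le_iSup₂ (f := fun (r : X × Y) (_ : r ∈ ρ) => ⨆ (t : X × Y) (_ : t ∈ ρ),
      ENNReal.ofReal |dist r.2 t.2 - dist r.1 t.1|) p hp)

/-- if `dom ρ` is `ε`-dense in `X`, `im ρ` is `μ`-dense in `Y`, and two points
`x₁, x₂ ∈ X` are represented by the same pixel `y ∈ Y` in the cartographic generalization `ρ̄`,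
then `d(x₁,x₂) ≤ 2(ε + μ) + acc(ρ)`. -/
theorem dist_le_of_cartGen (ρ : Set (X × Y)) (ε μ : ℝ) (hε : 0 < ε) (hμ : 0 < μ)
    (hdom : IsEpsDense (Prod.fst '' ρ) ε) (him : IsEpsDense (Prod.snd '' ρ) μ)
    (x₁ x₂ : X) (y : Y) (h₁ : (x₁, y) ∈ cartGen ρ ε μ) (h₂ : (x₂, y) ∈ cartGen ρ ε μ) :
    ENNReal.ofReal (dist x₁ x₂) ≤ ENNReal.ofReal (2 * (ε + μ)) + accRel ρ := by
  obtain ⟨p, hp, hpx, hpy⟩ := h₁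
  obtain ⟨q, hq, hqx, hqy⟩ := h₂
  have hpq : dist x₁ x₂ ≤ 2 * (ε + μ) + |dist p.2 q.2 - dist p.1 q.1| := by
    have hx := dist_triangle4 x₁ p.1 q.1 x₂
    have hy := dist_triangle_left p.2 q.2 y
    have habs := neg_abs_le (dist p.2 q.2 - dist p.1 q.1)
    rw [dist_comm q.1 x₂] at hx
    dsimp only at hpx hpy hqx hqy
    linarith
  calc ENNReal.ofReal (dist x₁ x₂)
      ≤ ENNReal.ofReal (2 * (ε + μ)) + ENNReal.ofReal |dist p.2 q.2 - dist p.1 q.1| :=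
        (ENNReal.ofReal_le_ofReal hpq).trans ENNReal.ofReal_add_le
    _ ≤ ENNReal.ofReal (2 * (ε + μ)) + accRel ρ :=
        add_le_add_right (ofReal_abs_dist_sub_dist_le_accRel hp hq) _
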